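/- arXiv:math/0602544 — 2 statements merged into one kernel-verified Lean document; each statement's English description precedes it below -/
import Mathlib

section
/- If M is a pure λ-term (containing no pairing or projection constructs) and N is a pure λ-term, and M = N is derivable in the theory βη-SP (the untyped extensional lambda calculus extended with surjective pairing axioms π₁⟨M,N⟩ = M, π₂⟨M,N⟩ = N, ⟨π₁M, π₂M⟩ = M), then M = N is already derivable in the theory βη. -/
/-- Untyped lambda terms with pairing and projections, de Bruijn representation
(so terms are automatically identified up to alpha-equivalence). -/
inductive Tm : Type
  | var : Nat → Tm
  | app : Tm → Tm → Tm
  | lam : Tm → Tm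
  | pair : Tm → Tm → Tm
  | p1 : Tm → Tm
  | p2 : Tm → Tm

/-- Shift free de Bruijn indices ≥ d up by one. -/
def Tm.lift (d : Nat) : Tm → Tm
  | .var n => if n < d then .var n else .var (n + 1)
  | .app a b => .app (a.lift d) (b.lift d)
  | .lam a => .lam (a.lift (d + 1))
  | .pair a b => .pair (a.lift d) (b.lift d)
  | .p1 a => .p1 (a.lift d)
  | .p2 a => .p2 (a.lift d)

/-- Capture-avoiding substitution of s for variable k. -/
def Tm.subst : Tm → Nat → Tm → Tm
  | .var n, k, s => if n = k then s else if n < k then .var n else .var (n - 1)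
  | .app a b, k, s => .app (a.subst k s) (b.subst k s)
  | .lam a, k, s => .lam (a.subst (k + 1) (s.lift 0))
  | .pair a b, k, s => .pair (a.subst k s) (b.subst k s)
  | .p1 a, k, s => .p1 (a.subst k s)
  | .p2 a, k, s => .p2 (a.subst k s)

/-- Pure lambda terms (no pairing or projections), de Bruijn representation. -/
inductive PTm : Type
  | var : Nat → PTm
  | app : PTm → PTm → PTm
  | lam : PTm → PTm

def PTm.lift (d : Nat) : PTm → PTm
  | .var n => if n < d then .var n else .var (n + 1)
  | .app a b => .app (a.lift d) (b.lift d)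
  | .lam a => .lam (a.lift (d + 1))

def PTm.subst : PTm → Nat → PTm → PTm
  | .var n, k, s => if n = k then s else if n < k then .var n else .var (n - 1)
  | .app a b, k, s => .app (a.subst k s) (b.subst k s)
  | .lam a, k, s => .lam (a.subst (k + 1) (s.lift 0))

/-- βη-equivalence of pure lambda terms: the smallest congruence containing (β) and (η). -/
inductive BetaEta : PTm → PTm → Prop
  | beta {M N} : BetaEta (.app (.lam M) N) (M.subst 0 N)
  | eta {M} : BetaEta (.lam (.app (M.lift 0) (.var 0))) M
  | refl {M} : BetaEta M M
  | symm {M N} : BetaEta M N → BetaEta N M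
  | trans {M N P} : BetaEta M N → BetaEta N P → BetaEta M P
  | app {M M' N N'} : BetaEta M M' → BetaEta N N' → BetaEta (.app M N) (.app M' N')
  | lam {M M'} : BetaEta M M' → BetaEta (.lam M) (.lam M')

/-- Inclusion of pure terms into the full term language. -/
def PTm.embed : PTm → Tm
  | .var n => .var n
  | .app a b => .app a.embed b.embed
  | .lam a => .lam a.embed

/-- The theory βη-SP: the smallest congruence containing (β), (η), (π₁), (π₂), (SP). -/
inductive EqSP : Tm → Tm → Prop
  | beta {M N} : EqSP (.app (.lam M) N) (M.subst 0 N)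
  | eta {M} : EqSP (.lam (.app (M.lift 0) (.var 0))) M
  | pi1 {M N} : EqSP (.p1 (.pair M N)) M
  | pi2 {M N} : EqSP (.p2 (.pair M N)) N
  | sp {M} : EqSP (.pair (.p1 M) (.p2 M)) M
  | refl {M} : EqSP M M
  | symm {M N} : EqSP M N → EqSP N M
  | trans {M N P} : EqSP M N → EqSP N P → EqSP M P
  | app {M M' N N'} : EqSP M M' → EqSP N N' → EqSP (.app M N) (.app M' N')
  | lam {M M'} : EqSP M M' → EqSP (.lam M) (.lam M')
  | pair {M M' N N'} : EqSP M M' → EqSP N N' → EqSP (.pair M N) (.pair M' N')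
  | p1 {M M'} : EqSP M M' → EqSP (.p1 M) (.p1 M')
  | p2 {M M'} : EqSP M M' → EqSP (.p2 M) (.p2 M')

namespace PTm

theorem lift_lift (M : PTm) : ∀ {i d : Nat}, i ≤ d →
    (M.lift d).lift i = (M.lift i).lift (d + 1) := by
  induction M with
  | var n => intro i d h; grind [lift]
  | app a b iha ihb => intro i d h; simp [lift, iha h, ihb h]
  | lam a ih => intro i d h; simp [lift, ih (Nat.succ_le_succ h)]

theorem lift_subst_of_le (M : PTm) : ∀ {k d : Nat} {N : PTm}, k ≤ d →
    (M.subst k N).lift d = (M.lift (d + 1)).subst k (N.lift d) := by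
  induction M with
  | var n => intro k d N h; grind [lift, subst]
  | app a b iha ihb => intro k d N h; simp [lift, subst, iha h, ihb h]
  | lam a ih =>
    intro k d N h
    simp [lift, subst, ih (Nat.succ_le_succ h), lift_lift N (Nat.zero_le d)]

theorem lift_subst_of_ge (M : PTm) : ∀ {k d : Nat} {N : PTm}, d ≤ k →
    (M.subst k N).lift d = (M.lift d).subst (k + 1) (N.lift d) := by
  induction M with
  | var n => intro k d N h; grind [lift, subst]
  | app a b iha ihb => intro k d N h; simp [lift, subst, iha h, ihb h]
  | lam a ih =>
    intro k d N h
    simp [lift, subst, ih (Nat.succ_le_succ h), lift_lift N (Nat.zero_le d)]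

theorem subst_lift_cancel (M : PTm) : ∀ {k : Nat} {N : PTm}, (M.lift k).subst k N = M := by
  induction M with
  | var n => intro k N; grind [lift, subst]
  | app a b iha ihb => intro k N; simp [lift, subst, iha, ihb]
  | lam a ih => intro k N; simp [lift, subst, ih]

theorem subst_subst (M : PTm) : ∀ {j k : Nat} {N P : PTm}, j ≤ k →
    (M.subst j N).subst k P = (M.subst (k + 1) (P.lift j)).subst j (N.subst k P) := by
  induction M with
  | var n => intro j k N P h; grind [subst, subst_lift_cancel]
  | app a b iha ihb => intro j k N P h; simp [subst, iha h, ihb h]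
  | lam a ih =>
    intro j k N P h
    simp [subst, ih (Nat.succ_le_succ h), lift_lift P (Nat.zero_le j),
      lift_subst_of_ge N (Nat.zero_le k)]

end PTm

namespace BetaEta

theorem lift {M N : PTm} (h : BetaEta M N) : ∀ d, BetaEta (M.lift d) (N.lift d) := by
  induction h with
  | beta =>
    intro d
    rw [PTm.lift_subst_of_le _ (Nat.zero_le d)]
    exact .beta
  | @eta M =>
    intro d
    simp only [PTm.lift, ← PTm.lift_lift M (Nat.zero_le d), Nat.zero_lt_succ, if_true]
    exact .eta
  | refl => intro d; exact .refl
  | symm _ ih => intro d; exact (ih d).symm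
  | trans _ _ ih₁ ih₂ => intro d; exact (ih₁ d).trans (ih₂ d)
  | app _ _ ih₁ ih₂ => intro d; exact .app (ih₁ d) (ih₂ d)
  | lam _ ih => intro d; exact .lam (ih (d + 1))

theorem subst {M N : PTm} (h : BetaEta M N) :
    ∀ k P, BetaEta (M.subst k P) (N.subst k P) := by
  induction h with
  | beta =>
    intro k P
    rw [PTm.subst_subst _ (Nat.zero_le k)]
    exact .beta
  | @eta M =>
    intro k P
    simp only [PTm.subst, ← PTm.lift_subst_of_ge M (Nat.zero_le k), Nat.zero_lt_succ, if_true,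
      (Nat.succ_ne_zero k).symm, if_false]
    exact .eta
  | refl => intro k P; exact .refl
  | symm _ ih => intro k P; exact (ih k P).symm
  | trans _ _ ih₁ ih₂ => intro k P; exact (ih₁ k P).trans (ih₂ k P)
  | app _ _ ih₁ ih₂ => intro k P; exact .app (ih₁ k P) (ih₂ k P)
  | lam _ ih => intro k P; exact .lam (ih (k + 1) (P.lift 0))

theorem of_lift {M N : PTm} {d : Nat} (h : BetaEta (M.lift d) (N.lift d)) : BetaEta M N := by
  simpa only [PTm.subst_lift_cancel] using h.subst d (.var 0)

end BetaEta

/-- Lambda terms in which every binder binds a countable family of variables and every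
application takes a countable family of arguments. The variable `var n j` is the `j`-th
component of the family with de Bruijn index `n`. -/
inductive FamTm : Type
  | var : Nat → Nat → FamTm
  | app : FamTm → (Nat → FamTm) → FamTm
  | lam : FamTm → FamTm

namespace FamTm

/-- Shift free de Bruijn indices ≥ d up by one. -/
def lift (d : Nat) : FamTm → FamTm
  | .var n j => if n < d then .var n j else .var (n + 1) j
  | .app a b => .app (a.lift d) (fun j => (b j).lift d)
  | .lam a => .lam (a.lift (d + 1))

/-- Capture-avoiding substitution of the family s for the variables of index k. -/
def subst : FamTm → Nat → (Nat → FamTm) → FamTm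
  | .var n j, k, s => if n = k then s j else if n < k then .var n j else .var (n - 1) j
  | .app a b, k, s => .app (a.subst k s) (fun j => (b j).subst k s)
  | .lam a, k, s => .lam (a.subst (k + 1) (fun j => (s j).lift 0))

theorem lift_lift (M : FamTm) : ∀ {i d : Nat}, i ≤ d →
    (M.lift d).lift i = (M.lift i).lift (d + 1) := by
  induction M with
  | var n j => intro i d h; grind [lift]
  | app a b iha ihb => intro i d h; simp [lift, iha h, fun j => ihb j h]
  | lam a ih => intro i d h; simp [lift, ih (Nat.succ_le_succ h)]

theorem lift_subst_of_le (M : FamTm) : ∀ {k d : Nat} {s : Nat → FamTm}, k ≤ d →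
    (M.subst k s).lift d = (M.lift (d + 1)).subst k (fun j => (s j).lift d) := by
  induction M with
  | var n j => intro k d s h; grind [lift, subst]
  | app a b iha ihb => intro k d s h; simp [lift, subst, iha h, funext fun j => ihb j h]
  | lam a ih =>
    intro k d s h
    simp [lift, subst, ih (Nat.succ_le_succ h), fun j => lift_lift (s j) (Nat.zero_le d)]

theorem lift_subst_of_ge (M : FamTm) : ∀ {k d : Nat} {s : Nat → FamTm}, d ≤ k →
    (M.subst k s).lift d = (M.lift d).subst (k + 1) (fun j => (s j).lift d) := by
  induction M with
  | var n j => intro k d s h; grind [lift, subst]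
  | app a b iha ihb => intro k d s h; simp [lift, subst, iha h, funext fun j => ihb j h]
  | lam a ih =>
    intro k d s h
    simp [lift, subst, ih (Nat.succ_le_succ h), fun j => lift_lift (s j) (Nat.zero_le d)]

theorem subst_lift_cancel (M : FamTm) :
    ∀ {k : Nat} {s : Nat → FamTm}, (M.lift k).subst k s = M := by
  induction M with
  | var n j => intro k s; grind [lift, subst]
  | app a b iha ihb => intro k s; simp [lift, subst, iha, ihb]
  | lam a ih => intro k s; simp [lift, subst, ih]

theorem lift_injective (d : Nat) : Function.Injective (lift d) := fun M N h => by
  rw [← M.subst_lift_cancel (k := d) (s := FamTm.var 0), h, subst_lift_cancel]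

theorem subst_lift_succ_var (M : FamTm) :
    ∀ {k : Nat}, (M.lift (k + 1)).subst k (FamTm.var k) = M := by
  induction M with
  | var n j => intro k; grind [lift, subst]
  | app a b iha ihb => intro k; simp [lift, subst, iha, ihb]
  | lam a ih =>
    intro k
    simp [lift, subst, ih]

theorem subst_subst (M : FamTm) : ∀ {i k : Nat} {s t : Nat → FamTm}, i ≤ k →
    (M.subst i s).subst k t =
      (M.subst (k + 1) (fun j => (t j).lift i)).subst i (fun j => (s j).subst k t) := by
  induction M with
  | var n j => intro i k s t h; grind [subst, subst_lift_cancel]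
  | app a b iha ihb => intro i k s t h; simp [subst, iha h, funext fun j => ihb j h]
  | lam a ih =>
    intro i k s t h
    simp [subst, ih (Nat.succ_le_succ h), fun j => lift_lift (t j) (Nat.zero_le i),
      funext fun j => (lift_subst_of_ge (s j) (Nat.zero_le k)).symm]

theorem exists_of_lift_eq_lift (M : FamTm) : ∀ {i d : Nat} {N : FamTm}, i ≤ d →
    M.lift (d + 1) = N.lift i → ∃ R : FamTm, M = R.lift i ∧ N = R.lift d := by
  induction M with
  | var n j =>
    intro i d N h e
    cases N with
    | var m l =>
      by_cases hn : n < i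
      · exact ⟨.var n j, by grind [lift], by grind [lift]⟩
      · exact ⟨.var (n - 1) j, by grind [lift], by grind [lift]⟩
    | app a b => grind [lift]
    | lam a => grind [lift]
  | app a b iha ihb =>
    intro i d N h e
    cases N with
    | var m l => grind [lift]
    | app a' b' =>
      simp only [lift, app.injEq] at e
      obtain ⟨R, rfl, rfl⟩ := iha h e.1
      choose S hS hS' using fun j => ihb j h (congrFun e.2 j)
      exact ⟨.app R S, by simp [lift, ← hS], by simp [lift, ← hS']⟩
    | lam a => grind [lift]
  | lam a ih =>
    intro i d N h e
    cases N with
    | var m l => grind [lift]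
    | app a b => grind [lift]
    | lam a' =>
      simp only [lift, lam.injEq] at e
      obtain ⟨R, rfl, rfl⟩ := ih (Nat.succ_le_succ h) e
      exact ⟨.lam R, rfl, rfl⟩

/-- Parallel βη-reduction. -/
inductive Par : FamTm → FamTm → Prop
  | var {n j} : Par (.var n j) (.var n j)
  | app {M M' N N'} : Par M M' → (∀ j, Par (N j) (N' j)) → Par (.app M N) (.app M' N')
  | lam {M M'} : Par M M' → Par (.lam M) (.lam M')
  | beta {M M' N N'} : Par M M' → (∀ j, Par (N j) (N' j)) →
      Par (.app (.lam M) N) (M'.subst 0 N')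
  | eta {M M'} : Par M M' → Par (.lam (.app (M.lift 0) (.var 0))) M'

namespace Par

theorem refl (M : FamTm) : Par M M := by
  induction M with
  | var n j => exact .var
  | app a b iha ihb => exact .app iha ihb
  | lam a ih => exact .lam ih

theorem lift {M N : FamTm} (h : Par M N) : ∀ d, Par (M.lift d) (N.lift d) := by
  induction h with
  | var => intro d; exact refl _
  | app _ _ ih₁ ih₂ => intro d; exact .app (ih₁ d) (fun j => ih₂ j d)
  | lam _ ih => intro d; exact .lam (ih (d + 1))
  | beta _ _ ih₁ ih₂ =>
    intro d
    rw [lift_subst_of_le _ (Nat.zero_le d)]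
    exact .beta (ih₁ (d + 1)) (fun j => ih₂ j d)
  | @eta M _ _ ih =>
    intro d
    simp only [FamTm.lift, ← lift_lift M (Nat.zero_le d), Nat.zero_lt_succ, if_true]
    exact .eta (ih d)

theorem subst {M N : FamTm} (h : Par M N) : ∀ (k : Nat) {s t : Nat → FamTm},
    (∀ j, Par (s j) (t j)) → Par (M.subst k s) (N.subst k t) := by
  induction h with
  | var =>
    intro k s t h
    simp only [FamTm.subst]
    split_ifs
    exacts [h _, refl _, refl _]
  | app _ _ ih₁ ih₂ => intro k s t h; exact .app (ih₁ k h) (fun j => ih₂ j k h)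
  | lam _ ih => intro k s t h; exact .lam (ih (k + 1) (fun j => (h j).lift 0))
  | beta _ _ ih₁ ih₂ =>
    intro k s t h
    rw [subst_subst _ (Nat.zero_le k)]
    exact .beta (ih₁ (k + 1) (fun j => (h j).lift 0)) (fun j => ih₂ j k h)
  | @eta M _ _ ih =>
    intro k s t h
    simp only [FamTm.subst, ← lift_subst_of_ge M (Nat.zero_le k), Nat.zero_lt_succ, if_true,
      (Nat.succ_ne_zero k).symm, if_false]
    exact .eta (ih k h)

theorem exists_of_lift {X Y : FamTm} (h : Par X Y) : ∀ {d : Nat} {M : FamTm},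
    X = M.lift d → ∃ N : FamTm, Y = N.lift d ∧ Par M N := by
  induction h with
  | @var n j => intro d M e; cases M <;> grind [FamTm.lift, Par.var]
  | app _ _ ih₁ ih₂ =>
    intro d M e
    cases M with
    | var n j => grind [FamTm.lift]
    | lam a => grind [FamTm.lift]
    | app a b =>
      simp only [FamTm.lift, FamTm.app.injEq] at e
      obtain ⟨a', rfl, ha⟩ := ih₁ e.1
      choose b' hb' hb using fun j => ih₂ j (congrFun e.2 j)
      exact ⟨.app a' b', by simp [FamTm.lift, ← hb'], .app ha hb⟩
  | lam _ ih =>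
    intro d M e
    cases M with
    | var n j => grind [FamTm.lift]
    | app a b => grind [FamTm.lift]
    | lam a =>
      simp only [FamTm.lift, FamTm.lam.injEq] at e
      obtain ⟨a', rfl, ha⟩ := ih e
      exact ⟨.lam a', rfl, .lam ha⟩
  | beta _ _ ih₁ ih₂ =>
    intro d M e
    cases M with
    | var n j => grind [FamTm.lift]
    | lam a => grind [FamTm.lift]
    | app a b =>
      cases a with
      | var n j => grind [FamTm.lift]
      | app a b => grind [FamTm.lift]
      | lam a =>
        simp only [FamTm.lift, FamTm.app.injEq, FamTm.lam.injEq] at e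
        obtain ⟨a', rfl, ha⟩ := ih₁ e.1
        choose b' hb' hb using fun j => ih₂ j (congrFun e.2 j)
        refine ⟨a'.subst 0 b', ?_, .beta ha hb⟩
        rw [lift_subst_of_le _ (Nat.zero_le d), funext hb']
  | eta _ ih =>
    intro d M e
    cases M with
    | var n j => grind [FamTm.lift]
    | app a b => grind [FamTm.lift]
    | lam a =>
      cases a with
      | var n j => grind [FamTm.lift]
      | lam a => grind [FamTm.lift]
      | app a b =>
        simp only [FamTm.lift, FamTm.app.injEq, FamTm.lam.injEq] at e
        obtain ⟨R, rfl, rfl⟩ := exists_of_lift_eq_lift a (Nat.zero_le d) e.1.symm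
        have hb : b = FamTm.var 0 := by
          funext j
          apply lift_injective (d + 1)
          simp [← congrFun e.2 j, FamTm.lift]
        obtain ⟨N, rfl, hN⟩ := ih rfl
        exact ⟨N, rfl, hb ▸ .eta hN⟩

theorem eq_var {n j : Nat} {X : FamTm} (h : Par (.var n j) X) : X = .var n j := by
  cases h; rfl

end Par

/-- Any two parallel reducts of `M` have a common parallel reduct. -/
def Diamond (M : FamTm) : Prop :=
  ∀ A B, Par M A → Par M B → ∃ C, Par A C ∧ Par B C

theorem Diamond.of_lift {M : FamTm} {d : Nat} (h : Diamond (M.lift d)) : Diamond M := by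
  intro A B hA hB
  obtain ⟨C, hAC, hBC⟩ := h _ _ (hA.lift d) (hB.lift d)
  obtain ⟨C, rfl, hAC'⟩ := hAC.exists_of_lift rfl
  obtain ⟨C', e, hBC'⟩ := hBC.exists_of_lift rfl
  exact ⟨C, hAC', lift_injective d e ▸ hBC'⟩

theorem Diamond.app_beta {P A₁ B₁ : FamTm} {N A₂ B₂ : Nat → FamTm} (hP : Diamond P)
    (hN : ∀ j, Diamond (N j)) (hA₁ : Par (.lam P) A₁) (hA₂ : ∀ j, Par (N j) (A₂ j))
    (hB₁ : Par P B₁) (hB₂ : ∀ j, Par (N j) (B₂ j)) :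
    ∃ C, Par (.app A₁ A₂) C ∧ Par (B₁.subst 0 B₂) C := by
  choose C hAC hBC using fun j => hN j _ _ (hA₂ j) (hB₂ j)
  cases hA₁ with
  | lam hA =>
    obtain ⟨D, hAD, hBD⟩ := hP _ _ hA hB₁
    exact ⟨D.subst 0 C, .beta hAD hAC, hBD.subst 0 hBC⟩
  | eta hA =>
    obtain ⟨D, hAD, hBD⟩ := hP _ _ (.app (hA.lift 0) fun j => .var) hB₁
    refine ⟨D.subst 0 C, ?_, hBD.subst 0 hBC⟩
    simpa [FamTm.subst, subst_lift_cancel] using hAD.subst 0 hAC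

theorem Diamond.lam_eta {R A B : FamTm} (hR : Diamond R)
    (hA : Par (.app (R.lift 0) (.var 0)) A) (hB : Par R B) :
    ∃ C, Par (.lam A) C ∧ Par B C := by
  generalize hX : R.lift 0 = X at hA
  cases hA with
  | @app _ S _ V hS hV =>
    obtain ⟨S, rfl, hRS⟩ := hS.exists_of_lift hX.symm
    obtain rfl : V = FamTm.var 0 := funext fun j => (hV j).eq_var
    obtain ⟨C, hSC, hBC⟩ := hR _ _ hRS hB
    exact ⟨C, .eta hSC, hBC⟩
  | @beta Q Q' _ V hQ hV =>
    obtain rfl : V = FamTm.var 0 := funext fun j => (hV j).eq_var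
    cases R with
    | var n j => grind [FamTm.lift]
    | app a b => grind [FamTm.lift]
    | lam R =>
      simp only [FamTm.lift, FamTm.lam.injEq] at hX
      obtain ⟨Q', rfl, hRQ⟩ := hQ.exists_of_lift hX.symm
      rw [subst_lift_succ_var]
      exact hR _ _ (.lam hRQ) hB

theorem diamond (M : FamTm) : Diamond M := by
  suffices h : Diamond M ∧ (∀ P, M = .lam P → Diamond P) ∧
      (∀ P N, M = .app P N → Diamond P) from h.1
  induction M with
  | var n j =>
    refine ⟨fun A B hA hB => ?_, by simp, by simp⟩
    rw [hA.eq_var, hB.eq_var]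
    exact ⟨_, .var, .var⟩
  | app a b iha ihb =>
    have hb := fun j => (ihb j).1
    refine ⟨fun A B hA hB => ?_, by simp, fun P N e => ?_⟩
    · cases hA with
      | app hA₁ hA₂ =>
        cases hB with
        | app hB₁ hB₂ =>
          obtain ⟨C, hAC, hBC⟩ := iha.1 _ _ hA₁ hB₁
          choose D hAD hBD using fun j => hb j _ _ (hA₂ j) (hB₂ j)
          exact ⟨.app C D, .app hAC hAD, .app hBC hBD⟩
        | beta hB₁ hB₂ => exact (iha.2.1 _ rfl).app_beta hb hA₁ hA₂ hB₁ hB₂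
      | beta hA₁ hA₂ =>
        have hP := iha.2.1 _ rfl
        cases hB with
        | app hB₁ hB₂ =>
          obtain ⟨C, hBC, hAC⟩ := hP.app_beta hb hB₁ hB₂ hA₁ hA₂
          exact ⟨C, hAC, hBC⟩
        | beta hB₁ hB₂ =>
          obtain ⟨C, hAC, hBC⟩ := hP _ _ hA₁ hB₁
          choose D hAD hBD using fun j => hb j _ _ (hA₂ j) (hB₂ j)
          exact ⟨C.subst 0 D, hAC.subst 0 hAD, hBC.subst 0 hBD⟩
    · cases e; exact iha.1
  | lam a ih =>
    refine ⟨fun A B hA hB => ?_, fun P e => ?_, by simp⟩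
    · cases hA with
      | lam hA =>
        cases hB with
        | lam hB =>
          obtain ⟨C, hAC, hBC⟩ := ih.1 _ _ hA hB
          exact ⟨.lam C, .lam hAC, .lam hBC⟩
        | eta hB => exact (ih.2.2 _ _ rfl).of_lift.lam_eta hA hB
      | eta hA =>
        have hR := (ih.2.2 _ _ rfl).of_lift
        generalize hX : FamTm.lam _ = X at hB
        cases hB with
        | lam hB =>
          cases hX
          obtain ⟨C, hBC, hAC⟩ := hR.lam_eta hB hA
          exact ⟨C, hAC, hBC⟩
        | eta hB =>
          simp only [FamTm.lam.injEq, FamTm.app.injEq, and_true] at hX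
          cases lift_injective 0 hX
          exact hR _ _ hA hB
        | var => cases hX
        | app => cases hX
        | beta => cases hX
    · cases e; exact ih.1

/-- Reduction by a chain of exactly `n` parallel steps. -/
def ParN : Nat → FamTm → FamTm → Prop
  | 0, M, N => M = N
  | n + 1, M, N => ∃ P, Par M P ∧ ParN n P N

namespace ParN

theorem refl (n : Nat) (M : FamTm) : ParN n M M := by
  induction n with
  | zero => rfl
  | succ n ih => exact ⟨M, .refl M, ih⟩

theorem trans {m : Nat} {N P : FamTm} (h₂ : ParN m N P) :
    ∀ {n : Nat} {M : FamTm}, ParN n M N → ParN (n + m) M P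
  | 0, M, h₁ => by cases h₁; simpa using h₂
  | n + 1, M, ⟨Q, hQ, h₁⟩ => by
    rw [Nat.succ_add]
    exact ⟨Q, hQ, h₂.trans h₁⟩

theorem mono {n m : Nat} {M N : FamTm} (h : ParN n M N) (hnm : n ≤ m) : ParN m M N := by
  obtain ⟨k, rfl⟩ := Nat.exists_eq_add_of_le hnm
  exact (refl k N).trans h

theorem app {M' : FamTm} {N' : Nat → FamTm} : ∀ {n : Nat} {M : FamTm} {N : Nat → FamTm},
    ParN n M M' → (∀ j, ParN n (N j) (N' j)) → ParN n (.app M N) (.app M' N')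
  | 0, _, _, h₁, h₂ => by cases h₁; cases funext h₂; rfl
  | n + 1, _, _, ⟨P, hP, h₁⟩, h₂ => by
    choose Q hQ h₂ using h₂
    exact ⟨.app P Q, .app hP hQ, app h₁ h₂⟩

theorem lam {M' : FamTm} : ∀ {n : Nat} {M : FamTm}, ParN n M M' → ParN n (.lam M) (.lam M')
  | 0, _, h => by cases h; rfl
  | _ + 1, _, ⟨P, hP, h⟩ => ⟨.lam P, .lam hP, lam h⟩

theorem strip {A : FamTm} : ∀ {n : Nat} {M B : FamTm}, Par M B → ParN n M A →
    ∃ C, Par A C ∧ ParN n B C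
  | 0, _, B, hB, h => by cases h; exact ⟨B, hB, rfl⟩
  | _ + 1, M, B, hB, ⟨P, hP, h⟩ => by
    obtain ⟨D, hPD, hBD⟩ := diamond M _ _ hP hB
    obtain ⟨C, hAC, hDC⟩ := strip hPD h
    exact ⟨C, hAC, D, hBD, hDC⟩

theorem confluent {m : Nat} {B : FamTm} : ∀ {n : Nat} {M A : FamTm}, ParN n M A → ParN m M B →
    ∃ C, ParN m A C ∧ ParN n B C
  | 0, _, _, hA, hB => by cases hA; exact ⟨B, hB, rfl⟩
  | _ + 1, _, _, ⟨P, hP, hA⟩, hB => by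
    obtain ⟨D, hBD, hPD⟩ := strip hP hB
    obtain ⟨C, hAC, hDC⟩ := confluent hA hPD
    exact ⟨C, hAC, D, hBD, hDC⟩

end ParN

/-- Two families of terms are joinable componentwise, in a number of parallel steps that does
not depend on the component. -/
def Joinable (s t : Nat → FamTm) : Prop :=
  ∃ n, ∀ i, ∃ C, ParN n (s i) C ∧ ParN n (t i) C

namespace Joinable

theorem of_par {s t : Nat → FamTm} (h : ∀ i, Par (s i) (t i)) : Joinable s t :=
  ⟨1, fun i => ⟨t i, ⟨_, h i, rfl⟩, .refl 1 _⟩⟩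

theorem refl (s : Nat → FamTm) : Joinable s s := of_par fun i => .refl (s i)

theorem symm {s t : Nat → FamTm} : Joinable s t → Joinable t s := fun ⟨n, h⟩ =>
  ⟨n, fun i => (h i).imp fun _ => And.symm⟩

theorem trans {s t u : Nat → FamTm} : Joinable s t → Joinable t u → Joinable s u :=
  fun ⟨n, h₁⟩ ⟨m, h₂⟩ => ⟨n + m, fun i => by
    obtain ⟨C, hsC, htC⟩ := h₁ i
    obtain ⟨D, htD, huD⟩ := h₂ i
    obtain ⟨E, hCE, hDE⟩ := htC.confluent htD
    exact ⟨E, hCE.trans hsC, Nat.add_comm m n ▸ hDE.trans huD⟩⟩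

theorem app {s s' t t' : Nat → FamTm} : Joinable s s' → Joinable t t' →
    Joinable (fun i => .app (s i) t) (fun i => .app (s' i) t') :=
  fun ⟨n, h₁⟩ ⟨m, h₂⟩ => ⟨n + m, fun i => by
    obtain ⟨C, hC, hC'⟩ := h₁ i
    choose D hD hD' using h₂
    have hn := Nat.le_add_right n m
    have hm := Nat.le_add_left m n
    exact ⟨.app C D, .app (hC.mono hn) fun j => (hD j).mono hm,
      .app (hC'.mono hn) fun j => (hD' j).mono hm⟩⟩

theorem lam {s t : Nat → FamTm} : Joinable s t →
    Joinable (fun i => .lam (s i)) (fun i => .lam (t i)) :=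
  fun ⟨n, h⟩ => ⟨n, fun i => (h i).elim fun C hC => ⟨.lam C, hC.1.lam, hC.2.lam⟩⟩

theorem comp {s t : Nat → FamTm} (f : Nat → Nat) : Joinable s t →
    Joinable (fun i => s (f i)) (fun i => t (f i)) :=
  fun ⟨n, h⟩ => ⟨n, fun i => h (f i)⟩

theorem ite {s s' t t' : Nat → FamTm} (p : Nat → Prop) [DecidablePred p] :
    Joinable s s' → Joinable t t' →
    Joinable (fun i => if p i then s i else t i) (fun i => if p i then s' i else t' i) :=
  fun ⟨n, h₁⟩ ⟨m, h₂⟩ => ⟨n + m, fun i => by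
    dsimp only
    split_ifs
    · exact (h₁ i).imp fun C hC =>
        ⟨hC.1.mono (Nat.le_add_right n m), hC.2.mono (Nat.le_add_right n m)⟩
    · exact (h₂ i).imp fun C hC =>
        ⟨hC.1.mono (Nat.le_add_left m n), hC.2.mono (Nat.le_add_left m n)⟩⟩

end Joinable

end FamTm

/-- Interpretation of terms with pairing as families of pairing-free terms: the components of a
pair are the even and the odd part of the family. -/
def Tm.interp : Tm → Nat → FamTm
  | .var n => FamTm.var n
  | .app a b => fun i => .app (a.interp i) b.interp
  | .lam a => fun i => .lam (a.interp i)
  | .pair a b => fun i => if i % 2 = 0 then a.interp (i / 2) else b.interp (i / 2)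
  | .p1 a => fun i => a.interp (2 * i)
  | .p2 a => fun i => a.interp (2 * i + 1)

namespace Tm

theorem interp_lift (M : Tm) : ∀ (d i : Nat), (M.lift d).interp i = (M.interp i).lift d := by
  induction M with
  | var n => intro d i; simp only [lift, interp, FamTm.lift]; split_ifs <;> rfl
  | app a b iha ihb => intro d i; simp [lift, interp, FamTm.lift, iha, funext (ihb d)]
  | lam a ih => intro d i; simp [lift, interp, FamTm.lift, ih]
  | pair a b iha ihb => intro d i; simp only [lift, interp, iha, ihb]; split_ifs <;> rfl
  | p1 a ih => intro d i; simp [lift, interp, ih]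
  | p2 a ih => intro d i; simp [lift, interp, ih]

theorem interp_subst (M : Tm) : ∀ (k : Nat) (N : Tm) (i : Nat),
    (M.subst k N).interp i = (M.interp i).subst k N.interp := by
  induction M with
  | var n => intro k N i; simp only [subst, interp, FamTm.subst]; split_ifs <;> rfl
  | app a b iha ihb => intro k N i; simp [subst, interp, FamTm.subst, iha, funext (ihb k N)]
  | lam a ih => intro k N i; simp [subst, interp, FamTm.subst, ih, funext (N.interp_lift 0)]
  | pair a b iha ihb => intro k N i; simp only [subst, interp, iha, ihb]; split_ifs <;> rfl
  | p1 a ih => intro k N i; simp [subst, interp, ih]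
  | p2 a ih => intro k N i; simp [subst, interp, ih]

end Tm

theorem EqSP.joinable {M N : Tm} (h : EqSP M N) : FamTm.Joinable M.interp N.interp := by
  induction h with
  | @beta M N =>
    refine .of_par fun i => ?_
    rw [Tm.interp_subst]
    exact .beta (.refl _) fun j => .refl _
  | @eta M =>
    refine .of_par fun i => ?_
    simp only [Tm.interp, Tm.interp_lift]
    exact .eta (.refl _)
  | @pi1 M N =>
    convert FamTm.Joinable.refl M.interp using 1
    funext i
    simp [Tm.interp]
  | @pi2 M N =>
    convert FamTm.Joinable.refl N.interp using 1
    funext i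
    simp only [Tm.interp]
    rw [if_neg (by omega), show (2 * i + 1) / 2 = i by omega]
  | @sp M =>
    convert FamTm.Joinable.refl M.interp using 1
    funext i
    simp only [Tm.interp]
    split_ifs
    · rw [show 2 * (i / 2) = i by omega]
    · rw [show 2 * (i / 2) + 1 = i by omega]
  | refl => exact .refl _
  | symm _ ih => exact ih.symm
  | trans _ _ ih₁ ih₂ => exact ih₁.trans ih₂
  | app _ _ ih₁ ih₂ => exact ih₁.app ih₂
  | lam _ ih => exact ih.lam
  | pair _ _ ih₁ ih₂ => exact .ite (· % 2 = 0) (ih₁.comp (· / 2)) (ih₂.comp (· / 2))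
  | p1 _ ih => exact ih.comp (2 * ·)
  | p2 _ ih => exact ih.comp (2 * · + 1)

namespace FamTm

/-- The pure term obtained by keeping only the zeroth argument of every application. -/
def erase : FamTm → PTm
  | .var n _ => .var n
  | .app a b => .app a.erase (b 0).erase
  | .lam a => .lam a.erase

/-- A term is coherent if the arguments in each family erase to βη-equal pure terms. -/
def Coherent : FamTm → Prop
  | .var _ _ => True
  | .app a b => a.Coherent ∧ (∀ j, (b j).Coherent) ∧ ∀ j, BetaEta (b j).erase (b 0).erase
  | .lam a => a.Coherent

theorem erase_lift (M : FamTm) : ∀ d, (M.lift d).erase = M.erase.lift d := by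
  induction M with
  | var n j => intro d; simp only [lift, erase, PTm.lift]; split_ifs <;> rfl
  | app a b iha ihb => intro d; simp [lift, erase, PTm.lift, iha, ihb]
  | lam a ih => intro d; simp [lift, erase, PTm.lift, ih]

theorem coherent_lift_iff (M : FamTm) : ∀ {d}, (M.lift d).Coherent ↔ M.Coherent := by
  induction M with
  | var n j => intro d; simp only [lift]; split_ifs <;> simp [Coherent]
  | app a b iha ihb =>
    intro d
    simp only [lift, Coherent, iha, ihb, erase_lift]
    have : ∀ j, BetaEta ((b j).erase.lift d) ((b 0).erase.lift d) ↔
        BetaEta (b j).erase (b 0).erase := fun j => ⟨.of_lift, fun h => h.lift d⟩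
    simp only [this]
  | lam a ih => intro d; simp only [lift, Coherent, ih]

theorem Coherent.subst {M : FamTm} (hM : M.Coherent) : ∀ (k : Nat) {s : Nat → FamTm} {t : PTm},
    (∀ j, (s j).Coherent) → (∀ j, BetaEta (s j).erase t) →
    (M.subst k s).Coherent ∧ BetaEta (M.subst k s).erase (M.erase.subst k t) := by
  induction M with
  | var n j =>
    intro k s t hs ht
    simp only [FamTm.subst, erase, PTm.subst]
    split_ifs
    · exact ⟨hs j, ht j⟩
    · exact ⟨trivial, .refl⟩
    · exact ⟨trivial, .refl⟩
  | app a b iha ihb =>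
    intro k s t hs ht
    obtain ⟨ha, hb, hab⟩ := hM
    have iha := iha ha k hs ht
    have ihb := fun j => ihb j (hb j) k hs ht
    exact ⟨⟨iha.1, fun j => (ihb j).1, fun j =>
      ((ihb j).2.trans ((hab j).subst k t)).trans (ihb 0).2.symm⟩, .app iha.2 (ihb 0).2⟩
  | lam a ih =>
    intro k s t hs ht
    have ih := ih hM (k + 1) (s := fun j => (s j).lift 0) (t := t.lift 0)
      (fun j => (coherent_lift_iff _).2 (hs j)) (fun j => by rw [erase_lift]; exact (ht j).lift 0)
    exact ⟨ih.1, .lam ih.2⟩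

theorem Par.coherent_and_betaEta {M N : FamTm} (h : Par M N) :
    M.Coherent → N.Coherent ∧ BetaEta M.erase N.erase := by
  induction h with
  | var => exact fun _ => ⟨trivial, .refl⟩
  | app _ _ ih₁ ih₂ =>
    rintro ⟨ha, hb, hab⟩
    have ih₂ := fun j => ih₂ j (hb j)
    exact ⟨⟨(ih₁ ha).1, fun j => (ih₂ j).1, fun j =>
      ((ih₂ j).2.symm.trans (hab j)).trans (ih₂ 0).2⟩, .app (ih₁ ha).2 (ih₂ 0).2⟩
  | lam _ ih => exact fun hM => ⟨(ih hM).1, .lam (ih hM).2⟩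
  | beta _ _ ih₁ ih₂ =>
    rintro ⟨ha, hb, hab⟩
    have ih₁ := ih₁ ha
    have ih₂ := fun j => ih₂ j (hb j)
    have hs := ih₁.1.subst 0 (fun j => (ih₂ j).1) fun j => (ih₂ j).2.symm.trans (hab j)
    exact ⟨hs.1, BetaEta.beta.trans ((ih₁.2.subst 0 _).trans hs.2.symm)⟩
  | eta _ ih =>
    rintro ⟨ha, -, -⟩
    have ih := ih ((coherent_lift_iff _).1 ha)
    simp only [erase, erase_lift]
    exact ⟨ih.1, BetaEta.eta.trans ih.2⟩

theorem ParN.betaEta {N : FamTm} : ∀ {n : Nat} {M : FamTm}, ParN n M N → M.Coherent →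
    BetaEta M.erase N.erase
  | 0, _, h, _ => by cases h; exact .refl
  | _ + 1, _, ⟨_, hP, h⟩, hM =>
    have hP := hP.coherent_and_betaEta hM
    hP.2.trans (h.betaEta hP.1)

end FamTm

theorem PTm.erase_interp_embed (M : PTm) : ∀ i, (M.embed.interp i).erase = M := by
  induction M with
  | var n => intro i; rfl
  | app a b iha ihb => intro i; simp [embed, Tm.interp, FamTm.erase, iha, ihb]
  | lam a ih => intro i; simp [embed, Tm.interp, FamTm.erase, ih]

theorem PTm.coherent_interp_embed (M : PTm) : ∀ i, (M.embed.interp i).Coherent := by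
  induction M with
  | var n => intro i; trivial
  | app a b iha ihb =>
    refine fun i => ⟨iha i, ihb, fun j => ?_⟩
    rw [erase_interp_embed, erase_interp_embed]
    exact .refl
  | lam a ih => exact ih

/-- βη-SP is conservative over βη: provably equal pure terms are βη-equal. -/
theorem conservativity_betaEtaSP (M N : PTm) (h : EqSP M.embed N.embed) :
    BetaEta M N := by
  obtain ⟨n, hn⟩ := h.joinable
  obtain ⟨C, hM, hN⟩ := hn 0
  have hMC := hM.betaEta (M.coherent_interp_embed 0)
  have hNC := hN.betaEta (N.coherent_interp_embed 0)
  rw [PTm.erase_interp_embed] at hMC hNC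
  exact hMC.trans hNC.symm
end

section
/- The reduction relation →_FP has the Church–Rosser property: if M =_FP N (the reflexive-symmetric-transitive closure of →_FP), then there exists a term P with M →_FP* P and N →_FP* P. -/
/-- One-step FP-reduction: compatible closure of (β), (η̄), (π₁), (π₂), (S̄P), (δπ), (π₁λ), (π₂λ). -/
inductive StepFP : Tm → Tm → Prop
  | beta {M N} : StepFP (.app (.lam M) N) (M.subst 0 N)
  | eta {M} : StepFP M (.lam (.app (M.lift 0) (.var 0)))
  | pi1 {M N} : StepFP (.p1 (.pair M N)) M
  | pi2 {M N} : StepFP (.p2 (.pair M N)) N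
  | sp {M} : StepFP M (.pair (.p1 M) (.p2 M))
  | dpi {M N P} : StepFP (.app (.pair M N) P) (.pair (.app M P) (.app N P))
  | pi1lam {M} : StepFP (.p1 (.lam M)) (.lam (.p1 M))
  | pi2lam {M} : StepFP (.p2 (.lam M)) (.lam (.p2 M))
  | lam {M M'} : StepFP M M' → StepFP (.lam M) (.lam M')
  | appL {M M' N} : StepFP M M' → StepFP (.app M N) (.app M' N)
  | appR {M N N'} : StepFP N N' → StepFP (.app M N) (.app M N')
  | pairL {M M' N} : StepFP M M' → StepFP (.pair M N) (.pair M' N)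
  | pairR {M N N'} : StepFP N N' → StepFP (.pair M N) (.pair M N')
  | p1 {M M'} : StepFP M M' → StepFP (.p1 M) (.p1 M')
  | p2 {M M'} : StepFP M M' → StepFP (.p2 M) (.p2 M')

namespace Tm

theorem lift_lift (M : Tm) {i j : Nat} (h : i ≤ j) :
    (M.lift j).lift i = (M.lift i).lift (j + 1) := by
  induction M generalizing i j with
  | var n => grind [lift]
  | lam a ih => simp only [lift, ih (Nat.succ_le_succ h)]
  | _ => simp_all [lift]

theorem subst_lift (M : Tm) (k : Nat) (s : Tm) : (M.lift k).subst k s = M := by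
  induction M generalizing k s with
  | var n => grind [lift, subst]
  | _ => simp_all [lift, subst]

theorem subst_lift_succ_var (M : Tm) (k : Nat) : (M.lift (k + 1)).subst k (var k) = M := by
  induction M generalizing k with
  | var n => grind [lift, subst]
  | _ => simp_all [lift, subst]

theorem lift_subst_of_le (M : Tm) {i k : Nat} (s : Tm) (h : i ≤ k) :
    (M.subst k s).lift i = (M.lift i).subst (k + 1) (s.lift i) := by
  induction M generalizing i k s with
  | var n => grind [lift, subst]
  | lam a ih => simp only [lift, subst, ih _ (Nat.succ_le_succ h), lift_lift s (Nat.zero_le i)]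
  | _ => simp_all [lift, subst]

theorem lift_subst_of_ge (M : Tm) {i k : Nat} (s : Tm) (h : k ≤ i) :
    (M.subst k s).lift i = (M.lift (i + 1)).subst k (s.lift i) := by
  induction M generalizing i k s with
  | var n => grind [lift, subst]
  | lam a ih => simp only [lift, subst, ih _ (Nat.succ_le_succ h), lift_lift s (Nat.zero_le i)]
  | _ => simp_all [lift, subst]

theorem subst_subst (M : Tm) {i k : Nat} (N s : Tm) (h : i ≤ k) :
    (M.subst i N).subst k s = (M.subst (k + 1) (s.lift i)).subst i (N.subst k s) := by
  induction M generalizing i k N s with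
  | var n =>
    rcases lt_trichotomy n i with h1 | rfl | h1
    · grind [lift, subst]
    · grind [lift, subst]
    · rcases lt_trichotomy n (k + 1) with h2 | rfl | h2
      · grind [lift, subst]
      · simp [subst, subst_lift, h1.ne', h1.not_gt]
      · grind [lift, subst]
  | lam a ih =>
    simp only [subst, ih _ _ (Nat.succ_le_succ h), lift_lift s (Nat.zero_le i),
      lift_subst_of_le N s (Nat.zero_le k)]
  | _ => simp_all [subst]

end Tm

open Relation Tm

/-- Parallel reduction for the rules of `StepFP` other than the two expansions. -/
inductive ParStep : Tm → Tm → Prop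
  | var (n) : ParStep (.var n) (.var n)
  | lam {M M'} : ParStep M M' → ParStep (.lam M) (.lam M')
  | app {M M' N N'} : ParStep M M' → ParStep N N' → ParStep (.app M N) (.app M' N')
  | pair {M M' N N'} : ParStep M M' → ParStep N N' → ParStep (.pair M N) (.pair M' N')
  | p1 {M M'} : ParStep M M' → ParStep (.p1 M) (.p1 M')
  | p2 {M M'} : ParStep M M' → ParStep (.p2 M) (.p2 M')
  | beta {M M' N N'} : ParStep M M' → ParStep N N' →
      ParStep (.app (.lam M) N) (M'.subst 0 N')
  | pi1 {M M' N} : ParStep M M' → ParStep (.p1 (.pair M N)) M'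
  | pi2 {M N N'} : ParStep N N' → ParStep (.p2 (.pair M N)) N'
  | dpi {M M' N N' P P'} : ParStep M M' → ParStep N N' → ParStep P P' →
      ParStep (.app (.pair M N) P) (.pair (.app M' P') (.app N' P'))
  | pi1lam {M M'} : ParStep M M' → ParStep (.p1 (.lam M)) (.lam (.p1 M'))
  | pi2lam {M M'} : ParStep M M' → ParStep (.p2 (.lam M)) (.lam (.p2 M'))

/-- Parallel expansion: every subterm may be expanded any number of times. -/
inductive ParExp : Tm → Tm → Prop
  | var (n) : ParExp (.var n) (.var n)
  | lam {M M'} : ParExp M M' → ParExp (.lam M) (.lam M')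
  | app {M M' N N'} : ParExp M M' → ParExp N N' → ParExp (.app M N) (.app M' N')
  | pair {M M' N N'} : ParExp M M' → ParExp N N' → ParExp (.pair M N) (.pair M' N')
  | p1 {M M'} : ParExp M M' → ParExp (.p1 M) (.p1 M')
  | p2 {M M'} : ParExp M M' → ParExp (.p2 M) (.p2 M')
  | eta {M M'} : ParExp M M' → ParExp M (.lam (.app (M'.lift 0) (.var 0)))
  | sp {M M'} : ParExp M M' → ParExp M (.pair (.p1 M') (.p2 M'))

/-- Reduction sequences of parallel steps. -/
abbrev ParSteps : Tm → Tm → Prop := ReflTransGen ParStep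

namespace ParStep

theorem rfl' (M : Tm) : ParStep M M := by
  induction M with
  | var n => exact var n
  | _ => constructor <;> assumption

theorem lift {M N : Tm} (h : ParStep M N) (i : Nat) : ParStep (M.lift i) (N.lift i) := by
  induction h generalizing i with
  | var n => exact rfl' _
  | beta _ _ ih₁ ih₂ =>
    rw [lift_subst_of_ge _ _ (Nat.zero_le i)]
    exact beta (ih₁ _) (ih₂ _)
  | _ => constructor <;> solve_by_elim

theorem subst {M M' N N' : Tm} (h : ParStep M M') (hN : ParStep N N') (k : Nat) :
    ParStep (M.subst k N) (M'.subst k N') := by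
  induction h generalizing k N N' with
  | var n =>
    simp only [Tm.subst]
    split_ifs
    exacts [hN, rfl' _, rfl' _]
  | beta _ _ ih₁ ih₂ =>
    rw [subst_subst _ _ _ (Nat.zero_le k)]
    exact beta (ih₁ (hN.lift 0) _) (ih₂ hN _)
  | lam _ ih => exact lam (ih (hN.lift 0) _)
  | pi1lam _ ih => exact pi1lam (ih (hN.lift 0) _)
  | pi2lam _ ih => exact pi2lam (ih (hN.lift 0) _)
  | _ => constructor <;> solve_by_elim

theorem lam_inv {M X : Tm} (h : ParStep (.lam M) X) : ∃ M', X = .lam M' ∧ ParStep M M' := by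
  cases h with
  | lam h => exact ⟨_, rfl, h⟩

theorem pair_inv {M N X : Tm} (h : ParStep (.pair M N) X) :
    ∃ M' N', X = .pair M' N' ∧ ParStep M M' ∧ ParStep N N' := by
  cases h with
  | pair h₁ h₂ => exact ⟨_, _, rfl, h₁, h₂⟩

theorem diamond {M N P : Tm} (h₁ : ParStep M N) (h₂ : ParStep M P) :
    ∃ Q, ParStep N Q ∧ ParStep P Q := by
  induction h₁ generalizing P with
  | var n => exact ⟨P, h₂, rfl' P⟩
  | lam _ ih =>
    cases h₂ with
    | lam h =>
      obtain ⟨Q, a, b⟩ := ih h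
      exact ⟨_, lam a, lam b⟩
  | pair _ _ ih₁ ih₂ =>
    cases h₂ with
    | pair h k =>
      obtain ⟨_, a, b⟩ := ih₁ h
      obtain ⟨_, c, d⟩ := ih₂ k
      exact ⟨_, pair a c, pair b d⟩
  | app h₁ _ ih₁ ih₂ =>
    cases h₂ with
    | app h k =>
      obtain ⟨_, a, b⟩ := ih₁ h
      obtain ⟨_, c, d⟩ := ih₂ k
      exact ⟨_, app a c, app b d⟩
    | beta h k =>
      obtain ⟨_, a, b⟩ := ih₁ (lam h)
      obtain ⟨_, c, d⟩ := ih₂ k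
      obtain ⟨_, rfl, b'⟩ := b.lam_inv
      obtain ⟨_, rfl, -⟩ := h₁.lam_inv
      cases a with
      | lam a => exact ⟨_, beta a c, b'.subst d 0⟩
    | dpi h h' k =>
      obtain ⟨_, a, b⟩ := ih₁ (pair h h')
      obtain ⟨_, c, d⟩ := ih₂ k
      obtain ⟨_, _, rfl, b, b'⟩ := b.pair_inv
      obtain ⟨_, _, rfl, -⟩ := h₁.pair_inv
      cases a with
      | pair a a' => exact ⟨_, dpi a a' c, pair (app b d) (app b' d)⟩
  | p1 h₁ ih =>
    cases h₂ with
    | p1 h =>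
      obtain ⟨_, a, b⟩ := ih h
      exact ⟨_, p1 a, p1 b⟩
    | pi1 h =>
      obtain ⟨_, _, rfl, -, k⟩ := h₁.pair_inv
      obtain ⟨_, a, b⟩ := ih (pair h k)
      obtain ⟨_, _, rfl, b, -⟩ := b.pair_inv
      cases a with
      | pair a _ => exact ⟨_, pi1 a, b⟩
    | pi1lam h =>
      obtain ⟨_, a, b⟩ := ih (lam h)
      obtain ⟨_, rfl, b'⟩ := b.lam_inv
      obtain ⟨_, rfl, -⟩ := h₁.lam_inv
      cases a with
      | lam a => exact ⟨_, pi1lam a, lam (p1 b')⟩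
  | p2 h₁ ih =>
    cases h₂ with
    | p2 h =>
      obtain ⟨_, a, b⟩ := ih h
      exact ⟨_, p2 a, p2 b⟩
    | pi2 h =>
      obtain ⟨_, _, rfl, k, -⟩ := h₁.pair_inv
      obtain ⟨_, a, b⟩ := ih (pair k h)
      obtain ⟨_, _, rfl, -, b⟩ := b.pair_inv
      cases a with
      | pair _ a => exact ⟨_, pi2 a, b⟩
    | pi2lam h =>
      obtain ⟨_, a, b⟩ := ih (lam h)
      obtain ⟨_, rfl, b'⟩ := b.lam_inv
      obtain ⟨_, rfl, -⟩ := h₁.lam_inv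
      cases a with
      | lam a => exact ⟨_, pi2lam a, lam (p2 b')⟩
  | beta _ _ ih₁ ih₂ =>
    cases h₂ with
    | app h k =>
      obtain ⟨_, rfl, h'⟩ := h.lam_inv
      obtain ⟨_, a, b⟩ := ih₁ h'
      obtain ⟨_, c, d⟩ := ih₂ k
      exact ⟨_, a.subst c 0, beta b d⟩
    | beta h k =>
      obtain ⟨_, a, b⟩ := ih₁ h
      obtain ⟨_, c, d⟩ := ih₂ k
      exact ⟨_, a.subst c 0, b.subst d 0⟩
  | dpi _ _ _ ih₁ ih₂ ih₃ =>
    cases h₂ with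
    | app h k =>
      obtain ⟨_, _, rfl, h, h'⟩ := h.pair_inv
      obtain ⟨_, a, b⟩ := ih₁ h
      obtain ⟨_, a', b'⟩ := ih₂ h'
      obtain ⟨_, c, d⟩ := ih₃ k
      exact ⟨_, pair (app a c) (app a' c), dpi b b' d⟩
    | dpi h h' k =>
      obtain ⟨_, a, b⟩ := ih₁ h
      obtain ⟨_, a', b'⟩ := ih₂ h'
      obtain ⟨_, c, d⟩ := ih₃ k
      exact ⟨_, pair (app a c) (app a' c), pair (app b d) (app b' d)⟩
  | pi1 _ ih =>
    cases h₂ with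
    | p1 h =>
      obtain ⟨_, _, rfl, h, -⟩ := h.pair_inv
      obtain ⟨_, a, b⟩ := ih h
      exact ⟨_, a, pi1 b⟩
    | pi1 h => exact ih h
  | pi2 _ ih =>
    cases h₂ with
    | p2 h =>
      obtain ⟨_, _, rfl, -, h⟩ := h.pair_inv
      obtain ⟨_, a, b⟩ := ih h
      exact ⟨_, a, pi2 b⟩
    | pi2 h => exact ih h
  | pi1lam _ ih =>
    cases h₂ with
    | p1 h =>
      obtain ⟨_, rfl, h'⟩ := h.lam_inv
      obtain ⟨_, a, b⟩ := ih h'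
      exact ⟨_, lam (p1 a), pi1lam b⟩
    | pi1lam h =>
      obtain ⟨_, a, b⟩ := ih h
      exact ⟨_, lam (p1 a), lam (p1 b)⟩
  | pi2lam _ ih =>
    cases h₂ with
    | p2 h =>
      obtain ⟨_, rfl, h'⟩ := h.lam_inv
      obtain ⟨_, a, b⟩ := ih h'
      exact ⟨_, lam (p2 a), pi2lam b⟩
    | pi2lam h =>
      obtain ⟨_, a, b⟩ := ih h
      exact ⟨_, lam (p2 a), lam (p2 b)⟩

end ParStep

namespace ParSteps

variable {M M' N N' : Tm}

theorem lam (h : ParSteps M M') : ParSteps (.lam M) (.lam M') :=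
  ReflTransGen.lift Tm.lam (fun _ _ => ParStep.lam) _ _ h

theorem p1 (h : ParSteps M M') : ParSteps (.p1 M) (.p1 M') :=
  ReflTransGen.lift Tm.p1 (fun _ _ => ParStep.p1) _ _ h

theorem p2 (h : ParSteps M M') : ParSteps (.p2 M) (.p2 M') :=
  ReflTransGen.lift Tm.p2 (fun _ _ => ParStep.p2) _ _ h

theorem app (h : ParSteps M M') (k : ParSteps N N') : ParSteps (.app M N) (.app M' N') :=
  (ReflTransGen.lift (Tm.app · N) (fun _ _ h => ParStep.app h (.rfl' N)) _ _ h).trans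
    (ReflTransGen.lift (Tm.app M') (fun _ _ => ParStep.app (.rfl' M')) _ _ k)

theorem pair (h : ParSteps M M') (k : ParSteps N N') : ParSteps (.pair M N) (.pair M' N') :=
  (ReflTransGen.lift (Tm.pair · N) (fun _ _ h => ParStep.pair h (.rfl' N)) _ _ h).trans
    (ReflTransGen.lift (Tm.pair M') (fun _ _ => ParStep.pair (.rfl' M')) _ _ k)

theorem lift (h : ParSteps M M') (i : Nat) : ParSteps (M.lift i) (M'.lift i) :=
  ReflTransGen.lift (Tm.lift i) (fun _ _ h => h.lift i) _ _ h

theorem subst (h : ParSteps M M') (k : Nat) (s : Tm) :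
    ParSteps (M.subst k s) (M'.subst k s) :=
  ReflTransGen.lift (Tm.subst · k s) (fun _ _ h => h.subst (.rfl' s) k) _ _ h

theorem beta (M N : Tm) : ParSteps (.app (.lam M) N) (M.subst 0 N) :=
  .single (.beta (.rfl' _) (.rfl' _))

theorem dpi (M N P : Tm) : ParSteps (.app (.pair M N) P) (.pair (.app M P) (.app N P)) :=
  .single (.dpi (.rfl' _) (.rfl' _) (.rfl' _))

theorem pi1 (M N : Tm) : ParSteps (.p1 (.pair M N)) M := .single (.pi1 (.rfl' _))

theorem pi2 (M N : Tm) : ParSteps (.p2 (.pair M N)) N := .single (.pi2 (.rfl' _))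

theorem pi1lam (M : Tm) : ParSteps (.p1 (.lam M)) (.lam (.p1 M)) := .single (.pi1lam (.rfl' _))

theorem pi2lam (M : Tm) : ParSteps (.p2 (.lam M)) (.lam (.p2 M)) := .single (.pi2lam (.rfl' _))

/-- Applying a weakened abstraction to the fresh variable recovers the body. -/
theorem beta_fresh (M : Tm) : ParSteps (.app ((Tm.lam M).lift 0) (.var 0)) M := by
  simpa only [Tm.lift, subst_lift_succ_var] using beta (M.lift 1) (.var 0)

theorem app_of_fresh {X Y : Tm} (h : ParSteps (.app (X.lift 0) (.var 0)) Y) (N : Tm) :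
    ParSteps (.app X N) (Y.subst 0 N) := by
  simpa [Tm.subst, subst_lift] using h.subst 0 N

end ParSteps

namespace ParExp

theorem rfl' (M : Tm) : ParExp M M := by
  induction M with
  | var n => exact var n
  | lam _ ih => exact lam ih
  | app _ _ ih₁ ih₂ => exact app ih₁ ih₂
  | pair _ _ ih₁ ih₂ => exact pair ih₁ ih₂
  | p1 _ ih => exact p1 ih
  | p2 _ ih => exact p2 ih

theorem lift {M N : Tm} (h : ParExp M N) (i : Nat) : ParExp (M.lift i) (N.lift i) := by
  induction h generalizing i with
  | var n => exact rfl' _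
  | lam _ ih => exact lam (ih _)
  | app _ _ ih₁ ih₂ => exact app (ih₁ _) (ih₂ _)
  | pair _ _ ih₁ ih₂ => exact pair (ih₁ _) (ih₂ _)
  | p1 _ ih => exact p1 (ih _)
  | p2 _ ih => exact p2 (ih _)
  | eta _ ih =>
    simpa [Tm.lift, lift_lift _ (Nat.zero_le i)] using eta (ih i)
  | sp _ ih => exact sp (ih _)

theorem subst {M M' N N' : Tm} (h : ParExp M M') (hN : ParExp N N') (k : Nat) :
    ParExp (M.subst k N) (M'.subst k N') := by
  induction h generalizing k N N' with
  | var n =>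
    simp only [Tm.subst]
    split_ifs
    exacts [hN, rfl' _, rfl' _]
  | lam _ ih => exact lam (ih (hN.lift 0) _)
  | app _ _ ih₁ ih₂ => exact app (ih₁ hN _) (ih₂ hN _)
  | pair _ _ ih₁ ih₂ => exact pair (ih₁ hN _) (ih₂ hN _)
  | p1 _ ih => exact p1 (ih hN _)
  | p2 _ ih => exact p2 (ih hN _)
  | eta _ ih =>
    simpa [Tm.subst, lift_subst_of_le _ _ (Nat.zero_le k)] using eta (ih hN k)
  | sp _ ih => exact sp (ih hN _)

theorem eta_congr {M N : Tm} (h : ParExp M N) :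
    ParExp (.lam (.app (M.lift 0) (.var 0))) (.lam (.app (N.lift 0) (.var 0))) :=
  lam (app (h.lift 0) (var 0))

theorem sp_congr {M N : Tm} (h : ParExp M N) :
    ParExp (.pair (.p1 M) (.p2 M)) (.pair (.p1 N) (.p2 N)) :=
  pair (p1 h) (p2 h)

theorem diamond {M N P : Tm} (h₁ : ParExp M N) (h₂ : ParExp M P) :
    ∃ Q, ParExp N Q ∧ ParExp P Q := by
  induction h₁ generalizing P with
  | eta _ ih =>
    obtain ⟨Q, a, b⟩ := ih h₂
    exact ⟨_, eta_congr a, eta b⟩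
  | sp _ ih =>
    obtain ⟨Q, a, b⟩ := ih h₂
    exact ⟨_, sp_congr a, sp b⟩
  | var n => exact ⟨P, h₂, rfl' P⟩
  | lam h₁ ih =>
    generalize hT : Tm.lam _ = T at h₂
    induction h₂ with cases hT
    | lam h =>
      obtain ⟨Q, a, b⟩ := ih h
      exact ⟨_, lam a, lam b⟩
    | eta _ ih' =>
      obtain ⟨Q, a, b⟩ := ih' rfl
      exact ⟨_, eta a, eta_congr b⟩
    | sp _ ih' =>
      obtain ⟨Q, a, b⟩ := ih' rfl
      exact ⟨_, sp a, sp_congr b⟩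
  | app h₁ h₁' ih₁ ih₂ =>
    generalize hT : Tm.app _ _ = T at h₂
    induction h₂ with cases hT
    | app h k =>
      obtain ⟨_, a, b⟩ := ih₁ h
      obtain ⟨_, c, d⟩ := ih₂ k
      exact ⟨_, app a c, app b d⟩
    | eta _ ih' =>
      obtain ⟨Q, a, b⟩ := ih' rfl
      exact ⟨_, eta a, eta_congr b⟩
    | sp _ ih' =>
      obtain ⟨Q, a, b⟩ := ih' rfl
      exact ⟨_, sp a, sp_congr b⟩
  | pair h₁ h₁' ih₁ ih₂ =>
    generalize hT : Tm.pair _ _ = T at h₂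
    induction h₂ with cases hT
    | pair h k =>
      obtain ⟨_, a, b⟩ := ih₁ h
      obtain ⟨_, c, d⟩ := ih₂ k
      exact ⟨_, pair a c, pair b d⟩
    | eta _ ih' =>
      obtain ⟨Q, a, b⟩ := ih' rfl
      exact ⟨_, eta a, eta_congr b⟩
    | sp _ ih' =>
      obtain ⟨Q, a, b⟩ := ih' rfl
      exact ⟨_, sp a, sp_congr b⟩
  | p1 h₁ ih =>
    generalize hT : Tm.p1 _ = T at h₂
    induction h₂ with cases hT
    | p1 h =>
      obtain ⟨Q, a, b⟩ := ih h
      exact ⟨_, p1 a, p1 b⟩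
    | eta _ ih' =>
      obtain ⟨Q, a, b⟩ := ih' rfl
      exact ⟨_, eta a, eta_congr b⟩
    | sp _ ih' =>
      obtain ⟨Q, a, b⟩ := ih' rfl
      exact ⟨_, sp a, sp_congr b⟩
  | p2 h₁ ih =>
    generalize hT : Tm.p2 _ = T at h₂
    induction h₂ with cases hT
    | p2 h =>
      obtain ⟨Q, a, b⟩ := ih h
      exact ⟨_, p2 a, p2 b⟩
    | eta _ ih' =>
      obtain ⟨Q, a, b⟩ := ih' rfl
      exact ⟨_, eta a, eta_congr b⟩
    | sp _ ih' =>
      obtain ⟨Q, a, b⟩ := ih' rfl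
      exact ⟨_, sp a, sp_congr b⟩

/-- How an expansion of an abstraction behaves under application and projections. -/
theorem lam_inv {M X : Tm} (h : ParExp (.lam M) X) :
    ∃ M', ParExp M M' ∧
      (∃ Z, (Z = M' ∨ Z = .pair (.p1 M') (.p2 M')) ∧
        ParSteps (.app (X.lift 0) (.var 0)) Z) ∧
      ParSteps (.p1 X) (.lam (.p1 M')) ∧ ParSteps (.p2 X) (.lam (.p2 M')) := by
  generalize hT : Tm.lam M = T at h
  induction h with cases hT
  | lam h =>
    exact ⟨_, h, ⟨_, .inl rfl, ParSteps.beta_fresh _⟩, ParSteps.pi1lam _, ParSteps.pi2lam _⟩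
  | eta _ ih =>
    obtain ⟨M', h, ⟨Z, hZ, a⟩, -, -⟩ := ih rfl
    refine ⟨M', h, ⟨Z, hZ, (ParSteps.beta_fresh _).trans a⟩,
      (ParSteps.pi1lam _).trans (ParSteps.lam (a.p1.trans ?_)),
      (ParSteps.pi2lam _).trans (ParSteps.lam (a.p2.trans ?_))⟩
    · rcases hZ with rfl | rfl
      exacts [.refl, ParSteps.pi1 _ _]
    · rcases hZ with rfl | rfl
      exacts [.refl, ParSteps.pi2 _ _]
  | sp _ ih =>
    obtain ⟨M', h, -, b, c⟩ := ih rfl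
    refine ⟨M', h, ⟨_, .inr rfl, (ParSteps.dpi _ _ _).trans (ParSteps.pair ?_ ?_)⟩,
      (ParSteps.pi1 _ _).trans b, (ParSteps.pi2 _ _).trans c⟩
    · exact (ParSteps.app (b.lift 0) .refl).trans (ParSteps.beta_fresh _)
    · exact (ParSteps.app (c.lift 0) .refl).trans (ParSteps.beta_fresh _)

/-- How an expansion of a pair behaves under application and projections. -/
theorem pair_inv {M N X : Tm} (h : ParExp (.pair M N) X) :
    ∃ M' N', ParExp M M' ∧ ParExp N N' ∧
      ParSteps (.app (X.lift 0) (.var 0))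
        (.pair (.app (M'.lift 0) (.var 0)) (.app (N'.lift 0) (.var 0))) ∧
      (∃ Z, (Z = M' ∨ Z = .lam (.app (M'.lift 0) (.var 0))) ∧ ParSteps (.p1 X) Z) ∧
      (∃ Z, (Z = N' ∨ Z = .lam (.app (N'.lift 0) (.var 0))) ∧ ParSteps (.p2 X) Z) := by
  generalize hT : Tm.pair M N = T at h
  induction h with cases hT
  | pair h k =>
    exact ⟨_, _, h, k, ParSteps.dpi _ _ _, ⟨_, .inl rfl, ParSteps.pi1 _ _⟩,
      ⟨_, .inl rfl, ParSteps.pi2 _ _⟩⟩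
  | eta _ ih =>
    obtain ⟨M', N', h, k, a, -, -⟩ := ih rfl
    exact ⟨M', N', h, k, (ParSteps.beta_fresh _).trans a,
      ⟨_, .inr rfl, (ParSteps.pi1lam _).trans (ParSteps.lam (a.p1.trans (ParSteps.pi1 _ _)))⟩,
      ⟨_, .inr rfl, (ParSteps.pi2lam _).trans (ParSteps.lam (a.p2.trans (ParSteps.pi2 _ _)))⟩⟩
  | sp _ ih =>
    obtain ⟨M', N', h, k, -, ⟨Y, hY, b⟩, ⟨Z, hZ, c⟩⟩ := ih rfl
    refine ⟨M', N', h, k, (ParSteps.dpi _ _ _).trans (ParSteps.pair ?_ ?_),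
      ⟨Y, hY, (ParSteps.pi1 _ _).trans b⟩, ⟨Z, hZ, (ParSteps.pi2 _ _).trans c⟩⟩
    · refine (ParSteps.app (b.lift 0) .refl).trans ?_
      rcases hY with rfl | rfl
      exacts [.refl, ParSteps.beta_fresh _]
    · refine (ParSteps.app (c.lift 0) .refl).trans ?_
      rcases hZ with rfl | rfl
      exacts [.refl, ParSteps.beta_fresh _]

/-- A parallel expansion can be postponed after a parallel step. -/
theorem commute_parStep {M P N : Tm} (h : ParExp M P) (r : ParStep M N) :
    ∃ Q, ParSteps P Q ∧ ParExp N Q := by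
  induction h generalizing N with
  | eta _ ih =>
    obtain ⟨Q, a, b⟩ := ih r
    exact ⟨_, ParSteps.lam (ParSteps.app (a.lift 0) .refl), eta b⟩
  | sp _ ih =>
    obtain ⟨Q, a, b⟩ := ih r
    exact ⟨_, ParSteps.pair a.p1 a.p2, sp b⟩
  | var n =>
    cases r
    exact ⟨_, .refl, var n⟩
  | lam _ ih =>
    cases r with
    | lam r =>
      obtain ⟨Q, a, b⟩ := ih r
      exact ⟨_, a.lam, lam b⟩
  | pair _ _ ih₁ ih₂ =>
    cases r with
    | pair r s =>
      obtain ⟨_, a, b⟩ := ih₁ r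
      obtain ⟨_, c, d⟩ := ih₂ s
      exact ⟨_, ParSteps.pair a c, pair b d⟩
  | app _ _ ih₁ ih₂ =>
    cases r with
    | app r s =>
      obtain ⟨_, a, b⟩ := ih₁ r
      obtain ⟨_, c, d⟩ := ih₂ s
      exact ⟨_, ParSteps.app a c, app b d⟩
    | beta r s =>
      obtain ⟨_, a, b⟩ := ih₁ (.lam r)
      obtain ⟨B, c, d⟩ := ih₂ s
      obtain ⟨M', h, ⟨Z, hZ, e⟩, -⟩ := b.lam_inv
      refine ⟨_, (ParSteps.app a c).trans (ParSteps.app_of_fresh e _), ?_⟩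
      rcases hZ with rfl | rfl
      exacts [h.subst d 0, sp (h.subst d 0)]
    | dpi r r' s =>
      obtain ⟨_, a, b⟩ := ih₁ (.pair r r')
      obtain ⟨B, c, d⟩ := ih₂ s
      obtain ⟨M', N', h, k, e, -⟩ := b.pair_inv
      refine ⟨_, (ParSteps.app a c).trans (ParSteps.app_of_fresh e _), ?_⟩
      simpa [Tm.subst, subst_lift] using pair (app h d) (app k d)
  | p1 _ ih =>
    cases r with
    | p1 r =>
      obtain ⟨_, a, b⟩ := ih r
      exact ⟨_, a.p1, p1 b⟩
    | pi1 r =>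
      obtain ⟨_, a, b⟩ := ih (.pair r (.rfl' _))
      obtain ⟨M', N', h, -, -, ⟨Z, hZ, e⟩, -⟩ := b.pair_inv
      refine ⟨Z, a.p1.trans e, ?_⟩
      rcases hZ with rfl | rfl
      exacts [h, eta h]
    | pi1lam r =>
      obtain ⟨_, a, b⟩ := ih (.lam r)
      obtain ⟨M', h, -, e, -⟩ := b.lam_inv
      exact ⟨_, a.p1.trans e, lam (p1 h)⟩
  | p2 _ ih =>
    cases r with
    | p2 r =>
      obtain ⟨_, a, b⟩ := ih r
      exact ⟨_, a.p2, p2 b⟩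
    | pi2 r =>
      obtain ⟨_, a, b⟩ := ih (.pair (.rfl' _) r)
      obtain ⟨M', N', -, h, -, -, ⟨Z, hZ, e⟩⟩ := b.pair_inv
      refine ⟨Z, a.p2.trans e, ?_⟩
      rcases hZ with rfl | rfl
      exacts [h, eta h]
    | pi2lam r =>
      obtain ⟨_, a, b⟩ := ih (.lam r)
      obtain ⟨M', h, -, -, e⟩ := b.lam_inv
      exact ⟨_, a.p2.trans e, lam (p2 h)⟩

end ParExp

/-- Commutation of two relations lifts to their reflexive-transitive closures. -/
theorem commute_reflTransGen {α : Type*} {r s : α → α → Prop}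
    (hrs : ∀ a b c, r a b → s a c → ∃ d, ReflTransGen s b d ∧ r c d) {a b c : α}
    (hr : ReflTransGen r a b) (hs : ReflTransGen s a c) :
    ∃ d, ReflTransGen s b d ∧ ReflTransGen r c d := by
  have strip : ∀ {a b c}, r a b → ReflTransGen s a c → ∃ d, ReflTransGen s b d ∧ r c d := by
    intro a b c h k
    induction k with
    | refl => exact ⟨b, .refl, h⟩
    | tail _ k ih =>
      obtain ⟨d, h₁, h₂⟩ := ih
      obtain ⟨e, h₃, h₄⟩ := hrs _ _ _ h₂ k
      exact ⟨e, h₁.trans h₃, h₄⟩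
  induction hr with
  | refl => exact ⟨c, hs, .refl⟩
  | tail _ h ih =>
    obtain ⟨d, h₁, h₂⟩ := ih
    obtain ⟨e, h₃, h₄⟩ := strip h h₁
    exact ⟨e, h₃, h₂.tail h₄⟩

/-- The diamond property lifts to the reflexive-transitive closure. -/
theorem diamond_reflTransGen {α : Type*} {r : α → α → Prop}
    (hr : ∀ a b c, r a b → r a c → ∃ d, r b d ∧ r c d) {a b c : α}
    (h : ReflTransGen r a b) (k : ReflTransGen r a c) :
    ∃ d, ReflTransGen r b d ∧ ReflTransGen r c d :=
  commute_reflTransGen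
    (fun a b c h k => (hr a b c h k).imp fun _ h => ⟨.single h.1, h.2⟩) h k

/-- Parallel steps followed by parallel expansions. -/
def ParStepsExps (M N : Tm) : Prop := ∃ K, ParSteps M K ∧ ReflTransGen ParExp K N

theorem ParStepsExps.diamond {M N P : Tm} (h : ParStepsExps M N) (k : ParStepsExps M P) :
    ∃ Q, ParStepsExps N Q ∧ ParStepsExps P Q := by
  obtain ⟨K, a, b⟩ := h
  obtain ⟨L, c, d⟩ := k
  obtain ⟨R, e, f⟩ := diamond_reflTransGen (fun _ _ _ => ParStep.diamond) a c
  obtain ⟨A, g, i⟩ := commute_reflTransGen (fun _ _ _ => ParExp.commute_parStep) b e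
  obtain ⟨B, j, l⟩ := commute_reflTransGen (fun _ _ _ => ParExp.commute_parStep) d f
  obtain ⟨Q, m, n⟩ := diamond_reflTransGen (fun _ _ _ => ParExp.diamond) i l
  exact ⟨Q, ⟨A, g, m⟩, ⟨B, j, n⟩⟩

namespace StepFP

/-- Reduction sequences of `StepFP`. -/
abbrev Steps : Tm → Tm → Prop := ReflTransGen StepFP

variable {M M' N N' : Tm}

theorem steps_lam (h : Steps M M') : Steps (.lam M) (.lam M') :=
  ReflTransGen.lift Tm.lam (fun _ _ => lam) _ _ h

theorem steps_p1 (h : Steps M M') : Steps (.p1 M) (.p1 M') :=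
  ReflTransGen.lift Tm.p1 (fun _ _ => p1) _ _ h

theorem steps_p2 (h : Steps M M') : Steps (.p2 M) (.p2 M') :=
  ReflTransGen.lift Tm.p2 (fun _ _ => p2) _ _ h

theorem steps_app (h : Steps M M') (k : Steps N N') : Steps (.app M N) (.app M' N') :=
  (ReflTransGen.lift (Tm.app · N) (fun _ _ => appL) _ _ h).trans
    (ReflTransGen.lift (Tm.app M') (fun _ _ => appR) _ _ k)

theorem steps_pair (h : Steps M M') (k : Steps N N') : Steps (.pair M N) (.pair M' N') :=
  (ReflTransGen.lift (Tm.pair · N) (fun _ _ => pairL) _ _ h).trans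
    (ReflTransGen.lift (Tm.pair M') (fun _ _ => pairR) _ _ k)

theorem steps_of_parStep (h : ParStep M N) : Steps M N := by
  induction h with
  | var n => exact .refl
  | lam _ ih => exact steps_lam ih
  | app _ _ ih₁ ih₂ => exact steps_app ih₁ ih₂
  | pair _ _ ih₁ ih₂ => exact steps_pair ih₁ ih₂
  | p1 _ ih => exact steps_p1 ih
  | p2 _ ih => exact steps_p2 ih
  | beta _ _ ih₁ ih₂ => exact (steps_app (steps_lam ih₁) ih₂).tail beta
  | pi1 _ ih => exact ih.head pi1
  | pi2 _ ih => exact ih.head pi2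
  | dpi _ _ _ ih₁ ih₂ ih₃ => exact (steps_app (steps_pair ih₁ ih₂) ih₃).tail dpi
  | pi1lam _ ih => exact (steps_lam (steps_p1 ih)).head pi1lam
  | pi2lam _ ih => exact (steps_lam (steps_p2 ih)).head pi2lam

theorem steps_of_parExp (h : ParExp M N) : Steps M N := by
  induction h with
  | var n => exact .refl
  | lam _ ih => exact steps_lam ih
  | app _ _ ih₁ ih₂ => exact steps_app ih₁ ih₂
  | pair _ _ ih₁ ih₂ => exact steps_pair ih₁ ih₂
  | p1 _ ih => exact steps_p1 ih
  | p2 _ ih => exact steps_p2 ih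
  | eta _ ih => exact ih.tail eta
  | sp _ ih => exact ih.tail sp

theorem steps_of_parStepsExps (h : ParStepsExps M N) : Steps M N := by
  obtain ⟨K, a, b⟩ := h
  have a' := ReflTransGen.lift' (p := StepFP) id (fun _ _ => steps_of_parStep) _ _ a
  have b' := ReflTransGen.lift' (p := StepFP) id (fun _ _ => steps_of_parExp) _ _ b
  exact a'.trans b'

theorem parStep_or_parExp (h : StepFP M N) : ParStep M N ∨ ParExp M N := by
  induction h with
  | beta => exact .inl (.beta (.rfl' _) (.rfl' _))
  | eta => exact .inr (.eta (.rfl' _))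
  | pi1 => exact .inl (.pi1 (.rfl' _))
  | pi2 => exact .inl (.pi2 (.rfl' _))
  | sp => exact .inr (.sp (.rfl' _))
  | dpi => exact .inl (.dpi (.rfl' _) (.rfl' _) (.rfl' _))
  | pi1lam => exact .inl (.pi1lam (.rfl' _))
  | pi2lam => exact .inl (.pi2lam (.rfl' _))
  | lam _ ih => exact ih.imp .lam .lam
  | appL _ ih => exact ih.imp (.app · (.rfl' _)) (.app · (.rfl' _))
  | appR _ ih => exact ih.imp (.app (.rfl' _)) (.app (.rfl' _))
  | pairL _ ih => exact ih.imp (.pair · (.rfl' _)) (.pair · (.rfl' _))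
  | pairR _ ih => exact ih.imp (.pair (.rfl' _)) (.pair (.rfl' _))
  | p1 _ ih => exact ih.imp .p1 .p1
  | p2 _ ih => exact ih.imp .p2 .p2

theorem parStepsExps (h : StepFP M N) : ParStepsExps M N :=
  h.parStep_or_parExp.elim (fun h => ⟨N, .single h, .refl⟩) (fun h => ⟨M, .refl, .single h⟩)

theorem steps_confluent {P : Tm} (h : Steps M N) (k : Steps M P) :
    ∃ Q, Steps N Q ∧ Steps P Q := by
  have lift {A B : Tm} (h : Steps A B) : ReflTransGen ParStepsExps A B :=
    ReflTransGen.mono (fun _ _ => parStepsExps) _ _ h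
  have lower {A B : Tm} (h : ReflTransGen ParStepsExps A B) : Steps A B :=
    ReflTransGen.lift' (p := StepFP) id (fun _ _ => steps_of_parStepsExps) _ _ h
  obtain ⟨Q, a, b⟩ := diamond_reflTransGen (fun _ _ _ => ParStepsExps.diamond) (lift h) (lift k)
  exact ⟨Q, lower a, lower b⟩

end StepFP

/-- →_FP has the Church–Rosser property. -/
theorem stepFP_churchRosser (M N : Tm) (h : Relation.EqvGen StepFP M N) :
    ∃ P, Relation.ReflTransGen StepFP M P ∧ Relation.ReflTransGen StepFP N P := by
  induction h with
  | rel _ N h => exact ⟨N, .single h, .refl⟩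
  | refl M => exact ⟨M, .refl, .refl⟩
  | symm _ _ _ ih =>
    obtain ⟨P, a, b⟩ := ih
    exact ⟨P, b, a⟩
  | trans _ _ _ _ _ ih₁ ih₂ =>
    obtain ⟨P, a, b⟩ := ih₁
    obtain ⟨Q, c, d⟩ := ih₂
    obtain ⟨R, e, f⟩ := StepFP.steps_confluent b c
    exact ⟨R, a.trans e, d.trans f⟩
end
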